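/- arXiv:1907.11948 — 3 statements merged into one kernel-verified Lean document; each statement's English description precedes it below -/
import Mathlib

section
/- Let P and Q be orthogonal projections on a complex Hilbert space H. Then Q·P·Q = P·Q·P if and only if P and Q commute, i.e. [P,Q] = 0. -/
/-- For orthogonal projections P and Q, QPQ = PQP iff [P,Q] = 0. -/
theorem QPQ_eq_PQP_iff_commutator_eq_zero
    {H : Type*} [NormedAddCommGroup H] [InnerProductSpace ℂ H] [CompleteSpace H]
    (P Q : H →L[ℂ] H)
    (hP1 : P * P = P) (hP2 : ContinuousLinearMap.adjoint P = P)
    (hQ1 : Q * Q = Q) (hQ2 : ContinuousLinearMap.adjoint Q = Q) :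
    Q * P * Q = P * Q * P ↔ P * Q - Q * P = 0 := by
  rw [← ContinuousLinearMap.star_eq_adjoint] at hP2 hQ2
  constructor
  · intro h
    rw [← CStarRing.star_mul_self_eq_zero_iff, star_sub, star_mul, star_mul, hP2, hQ2]
    have hQPQP : Q * P * Q * P = P * Q * P := by rw [h, mul_assoc, hP1]
    have hPQPQ : P * Q * P * Q = P * Q * P := by rw [← h, mul_assoc, hQ1]
    calc (Q * P - P * Q) * (P * Q - Q * P)
        = Q * (P * P) * Q - Q * P * Q * P - P * Q * P * Q + P * (Q * Q) * P := by noncomm_ring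
      _ = 0 := by rw [hP1, hQ1, hQPQP, hPQPQ, h]; abel
  · intro h
    have hPQ : P * Q = Q * P := sub_eq_zero.mp h
    rw [mul_assoc, hPQ, ← mul_assoc, hQ1, mul_assoc, hP1]
end

section
/- Let (P_x)_{x ∈ I} and (Q_y)_{y ∈ J} be families of orthogonal projections on a complex Hilbert space H. Suppose that for every vector ψ ∈ H and all indices x ∈ I, y ∈ J, the sequential measurement probabilities are symmetric: ⟨ψ, Q_y·P_x·Q_y ψ⟩ = ⟨ψ, P_x·Q_y·P_x ψ⟩. Then all the projections commute pairwise between families: P_x·Q_y = Q_y·P_x for all x ∈ I, y ∈ J. -/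
open ComplexInnerProductSpace

/-- In a C⋆-ring, star projections satisfying `q * p * q = p * q * p` commute. -/
theorem IsStarProjection.commute_of_mul_mul_eq {A : Type*} [NonUnitalNormedRing A] [StarRing A]
    [CStarRing A] {p q : A} (hp : IsStarProjection p) (hq : IsStarProjection q)
    (h : q * p * q = p * q * p) : Commute p q := by
  have hpp : p * p = p := hp.isIdempotentElem
  have hqq : q * q = q := hq.isIdempotentElem
  have hpqpq : p * q * p * q = q * p * q := by rw [← h, mul_assoc, hqq]
  have hqpqp : q * p * q * p = p * q * p := by rw [h, mul_assoc, hpp]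
  rw [commute_iff_eq, ← sub_eq_zero, ← CStarRing.star_mul_self_eq_zero_iff]
  calc star (p * q - q * p) * (p * q - q * p)
      = q * (p * p) * q - q * p * q * p - p * q * p * q + p * (q * q) * p := by
        rw [star_sub, star_mul, star_mul, hp.isSelfAdjoint.star_eq, hq.isSelfAdjoint.star_eq]
        noncomm_ring
    _ = 0 := by
        rw [hpp, hqq, hpqpq, hqpqp]
        abel

/-- If for all pure states ψ the sequential measurement probabilities
⟨ψ, Q_y P_x Q_y ψ⟩ and ⟨ψ, P_x Q_y P_x ψ⟩ are symmetric, then all projections of the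
two families commute pairwise. -/
theorem symmetric_sequential_probabilities_implies_compatible
    {H : Type*} [NormedAddCommGroup H] [InnerProductSpace ℂ H] [CompleteSpace H]
    {I J : Type*} (P : I → (H →L[ℂ] H)) (Q : J → (H →L[ℂ] H))
    (hP1 : ∀ x, P x * P x = P x) (hP2 : ∀ x, ContinuousLinearMap.adjoint (P x) = P x)
    (hQ1 : ∀ y, Q y * Q y = Q y) (hQ2 : ∀ y, ContinuousLinearMap.adjoint (Q y) = Q y)
    (hsym : ∀ (ψ : H) (x : I) (y : J),
      ⟪ψ, (Q y * P x * Q y) ψ⟫ = ⟪ψ, (P x * Q y * P x) ψ⟫) :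
    ∀ (x : I) (y : J), P x * Q y = Q y * P x := by
  intro x y
  refine IsStarProjection.commute_of_mul_mul_eq ⟨hP1 x, hP2 x⟩ ⟨hQ1 y, hQ2 y⟩ ?_
  refine ContinuousLinearMap.coe_injective ((ext_inner_map _ _).mp fun ψ => ?_)
  simpa only [inner_conj_symm, ContinuousLinearMap.coe_coe] using
    congrArg (starRingEnd ℂ) (hsym ψ x y)
end

section
/- (A Bell inequality, after Wigner.) Let μ be a measure on a measurable space Ω and let A, B, C be measurable sets. Then μ(A ∩ C) ≤ μ(A ∩ Bᶜ) + μ(B ∩ C). -/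
open MeasureTheory

/-- A Bell inequality, after Wigner: for a measure μ and measurable
sets A, B, C, we have μ(A ∩ C) ≤ μ(A ∩ Bᶜ) + μ(B ∩ C). -/
theorem bell_inequality_wigner
    {Ω : Type*} [MeasurableSpace Ω] (μ : Measure Ω) (A B C : Set Ω)
    (hA : MeasurableSet A) (hB : MeasurableSet B) (hC : MeasurableSet C) :
    μ (A ∩ C) ≤ μ (A ∩ Bᶜ) + μ (B ∩ C) := by
  have hsub : A ∩ C ⊆ (A ∩ Bᶜ) ∪ (B ∩ C) := by
    rintro x ⟨hxA, hxC⟩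
    by_cases hxB : x ∈ B
    · exact Or.inr ⟨hxB, hxC⟩
    · exact Or.inl ⟨hxA, hxB⟩
  exact (measure_mono hsub).trans (measure_union_le _ _)
end
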